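/- Let V be a nonzero finite-dimensional real vector space and let H be a subgroup of GL(V) that is connected in the norm topology and acts irreducibly on V. Then for every linear subspace W ⊆ V there exist a positive integer m and elements h₁, …, h_m ∈ H, depending only on W and not on W', such that for every linear subspace W' ⊆ V one has Σ_{j=1}^m dim((h_j·W) ∩ W') · dim V ≤ m · dim W · dim W'. -/

import Mathlib

open Module

/-- In a group with a Noetherian topology whose left translations are continuous, the irreducible
component of every point is open. -/
theorem isOpen_irreducibleComponent_of_continuous_mul_left {G : Type*} [Group G]
    [TopologicalSpace G] [TopologicalSpace.NoetherianSpace G]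
    (hc : ∀ g : G, Continuous (g * ·)) (x : G) : IsOpen (irreducibleComponent x) := by
  obtain ⟨U, hU, ⟨u, hu⟩, hUZ⟩ :=
    TopologicalSpace.NoetherianSpace.exists_isOpen_nonempty_subset_irreducibleComponent
      (irreducibleComponent x) (irreducibleComponent_mem_irreducibleComponents x)
  have hUirr : IsPreirreducible U :=
    isIrreducible_irreducibleComponent.isPreirreducible.open_subset hU hUZ
  refine isOpen_iff_forall_mem_open.2 fun y hy => ?_
  have himage : (fun z => y * u⁻¹ * z) '' U = (fun z => u * y⁻¹ * z) ⁻¹' U := by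
    ext z
    constructor
    · rintro ⟨w, hw, rfl⟩
      simpa [mul_assoc] using hw
    · intro hz
      exact ⟨_, hz, by simp [mul_assoc]⟩
  have hopen : IsOpen ((fun z => y * u⁻¹ * z) '' U) := himage ▸ hU.preimage (hc _)
  have hirr : IsPreirreducible ((fun z => y * u⁻¹ * z) '' U) :=
    hUirr.image _ (hc _).continuousOn
  have hymem : y ∈ (fun z => y * u⁻¹ * z) '' U := ⟨u, hu, by simp⟩
  refine ⟨_, ?_, hopen, hymem⟩
  have hsub := subset_closure_inter_of_isPreirreducible_of_isOpen
    (isIrreducible_irreducibleComponent (x := x)).isPreirreducible hopen ⟨y, hy, hymem⟩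
  rw [← eq_irreducibleComponent hirr.closure
    (hsub.trans (closure_mono Set.inter_subset_right))]
  exact subset_closure

/-- A preconnected group with a Noetherian topology whose left translations are continuous is
irreducible. -/
theorem isPreirreducible_univ_of_continuous_mul_left {G : Type*} [Group G]
    [TopologicalSpace G] [TopologicalSpace.NoetherianSpace G] [PreconnectedSpace G]
    (hc : ∀ g : G, Continuous (g * ·)) : IsPreirreducible (Set.univ : Set G) := by
  have huniv : irreducibleComponent (1 : G) = Set.univ :=
    IsClopen.eq_univ ⟨isClosed_irreducibleComponent,
      isOpen_irreducibleComponent_of_continuous_mul_left hc 1⟩ ⟨1, mem_irreducibleComponent⟩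
  exact huniv ▸ isIrreducible_irreducibleComponent.2

/-- A finitely generated algebra of continuous functions on a connected space carrying a group
structure, stable under left translations, has no zero divisors. -/
theorem Subalgebra.exists_ne_zero_and_ne_zero {G : Type*} [Group G] [TopologicalSpace G]
    [PreconnectedSpace G] (A : Subalgebra ℝ (G → ℝ)) (hfg : A.FG)
    (hcont : ∀ f ∈ A, Continuous f) (htrans : ∀ g : G, ∀ f ∈ A, (fun x => f (g * x)) ∈ A)
    {f₁ f₂ : G → ℝ} (hf₁ : f₁ ∈ A) (hf₂ : f₂ ∈ A) (h₁ : f₁ ≠ 0) (h₂ : f₂ ≠ 0) :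
    ∃ x, f₁ x ≠ 0 ∧ f₂ x ≠ 0 := by
  have : Algebra.FiniteType ℝ A := A.fg_iff_finiteType.1 hfg
  have : IsNoetherianRing A := Algebra.FiniteType.isNoetherianRing ℝ A
  let ev (x : G) : A →+* ℝ := (Pi.evalRingHom (fun _ : G => ℝ) x).comp A.val.toRingHom
  let ψ (x : G) : PrimeSpectrum A := PrimeSpectrum.comap (ev x) ⊥
  have hψ (x : G) (f : A) : ψ x ∈ PrimeSpectrum.basicOpen f ↔ f.1 x ≠ 0 := Iff.rfl
  let L (g : G) : A →+* A :=
    { toFun f := ⟨fun x => f.1 (g * x), htrans g f.1 f.2⟩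
      map_one' := rfl
      map_mul' _ _ := rfl
      map_zero' := rfl
      map_add' _ _ := rfl }
  have hψcont : Continuous ψ := by
    rw [PrimeSpectrum.isTopologicalBasis_basic_opens.continuous_iff]
    rintro _ ⟨f, rfl⟩
    exact isOpen_ne_fun (hcont f.1 f.2) continuous_const
  have hτ : @Continuous G G _ (TopologicalSpace.induced ψ inferInstance) id :=
    continuous_induced_rng.2 hψcont
  have huniv : IsPreconnected (Set.univ : Set G) := isPreconnected_univ
  have himage := @IsPreconnected.image G G _ (TopologicalSpace.induced ψ inferInstance) _ huniv id
    (@Continuous.continuousOn G G _ (TopologicalSpace.induced ψ inferInstance) _ _ hτ)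
  rw [Set.image_id] at himage
  let τ : TopologicalSpace G := TopologicalSpace.induced ψ inferInstance
  have hnoeth : @TopologicalSpace.NoetherianSpace G τ :=
    Topology.IsInducing.noetherianSpace (i := ψ) ⟨rfl⟩
  have hmul (g : G) : @Continuous G G τ τ (g * ·) := by
    refine continuous_induced_rng.2 ?_
    have h : ψ ∘ (g * ·) = PrimeSpectrum.comap (L g) ∘ ψ := rfl
    rw [h]
    exact (PrimeSpectrum.continuous_comap (L g)).comp continuous_induced_dom
  have hirr : @IsPreirreducible G τ Set.univ :=
    @isPreirreducible_univ_of_continuous_mul_left G _ τ hnoeth (@PreconnectedSpace.mk G τ himage)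
      hmul
  have hne (f : A) : @IsOpen G τ {x | f.1 x ≠ 0} :=
    ⟨PrimeSpectrum.basicOpen f, (PrimeSpectrum.basicOpen f).isOpen, rfl⟩
  obtain ⟨x₁, hx₁⟩ := Function.ne_iff.1 h₁
  obtain ⟨x₂, hx₂⟩ := Function.ne_iff.1 h₂
  obtain ⟨x, -, hx⟩ := hirr _ _ (hne ⟨f₁, hf₁⟩) (hne ⟨f₂, hf₂⟩) ⟨x₁, trivial, hx₁⟩
    ⟨x₂, trivial, hx₂⟩
  exact ⟨x, hx⟩

/-- If the nonvanishing loci of any two nonzero members of an algebra of functions intersect, then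
all such loci belong to a common proper filter. -/
theorem Subalgebra.exists_neBot_eventually_ne_zero {G : Type*} [Nonempty G]
    (A : Subalgebra ℝ (G → ℝ))
    (hA : ∀ f₁ ∈ A, ∀ f₂ ∈ A, f₁ ≠ 0 → f₂ ≠ 0 → ∃ x, f₁ x ≠ 0 ∧ f₂ x ≠ 0) :
    ∃ l : Filter G, l.NeBot ∧ ∀ f ∈ A, f ≠ 0 → ∀ᶠ x in l, f x ≠ 0 := by
  let l : Filter G :=
    { sets := {s | ∃ f ∈ A, f ≠ 0 ∧ {x | f x ≠ 0} ⊆ s}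
      univ_sets := ⟨1, A.one_mem, one_ne_zero, Set.subset_univ _⟩
      sets_of_superset := by
        rintro s t ⟨f, hf, hf0, hfs⟩ hst
        exact ⟨f, hf, hf0, hfs.trans hst⟩
      inter_sets := by
        rintro s t ⟨f₁, hf₁, h₁, hs⟩ ⟨f₂, hf₂, h₂, ht⟩
        obtain ⟨x, hx₁, hx₂⟩ := hA f₁ hf₁ f₂ hf₂ h₁ h₂
        refine ⟨f₁ * f₂, A.mul_mem hf₁ hf₂, Function.ne_iff.2 ⟨x, mul_ne_zero hx₁ hx₂⟩, ?_⟩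
        intro y hy
        exact ⟨hs (left_ne_zero_of_mul hy), ht (right_ne_zero_of_mul hy)⟩ }
  refine ⟨l, ⟨fun hbot => ?_⟩, fun f hf hf0 => ⟨f, hf, hf0, subset_rfl⟩⟩
  obtain ⟨f, -, hf0, hf⟩ : ∅ ∈ l := by simp [hbot]
  obtain ⟨x, hx⟩ := Function.ne_iff.1 hf0
  exact hf hx

/-- Points in general position for a finite-dimensional space of functions. -/
theorem Submodule.exists_seq_card_zeros_le {G K : Type*} [Field K] (P : Submodule K (G → K))
    [FiniteDimensional K P] (l : Filter G) [l.NeBot]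
    (hl : ∀ f ∈ P, f ≠ 0 → ∀ᶠ x in l, f x ≠ 0) (m : ℕ) :
    ∃ h : ℕ → G, ∀ f ∈ P, f ≠ 0 → ∀ J ⊆ Finset.range m, (∀ j ∈ J, f (h j) = 0) →
      J.card ≤ finrank K P := by
  classical
  let Z (h : ℕ → G) (J : Finset ℕ) : Submodule K P :=
    { carrier := {f | ∀ j ∈ J, f.1 (h j) = 0}
      add_mem' := fun {a b} ha hb j hj => by simp [ha j hj, hb j hj]
      zero_mem' := fun j _ => rfl
      smul_mem' := fun c f hf j hj => by simp [hf j hj] }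
  suffices H : ∃ h : ℕ → G, ∀ J ⊆ Finset.range m,
      Z h J = ⊥ ∨ finrank K (Z h J) + J.card ≤ finrank K P by
    obtain ⟨h, hh⟩ := H
    refine ⟨h, fun f hf hf0 J hJ hz => ?_⟩
    rcases hh J hJ with hbot | hle
    · have : (⟨f, hf⟩ : P) ∈ Z h J := hz
      rw [hbot, Submodule.mem_bot] at this
      exact absurd (congrArg Subtype.val this) hf0
    · omega
  induction m with
  | zero =>
    obtain ⟨g⟩ : Nonempty G := l.nonempty_of_neBot
    refine ⟨fun _ => g, fun J hJ => Or.inr ?_⟩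
    obtain rfl : J = ∅ := by simpa using hJ
    simpa using Submodule.finrank_le (Z (fun _ => g) ∅)
  | succ m ih =>
    obtain ⟨h, hh⟩ := ih
    have hev : ∀ᶠ x in l, ∀ J ∈ (Finset.range m).powerset, Z h J ≠ ⊥ →
        ∃ f ∈ Z h J, f.1 x ≠ 0 := by
      rw [Filter.eventually_all_finset]
      intro J _
      by_cases hJ : Z h J = ⊥
      · simp [hJ]
      · obtain ⟨f, hf, hf0⟩ := Submodule.exists_mem_ne_zero_of_ne_bot hJ
        filter_upwards [hl f.1 f.2 (by simpa using hf0)] with x hx _ using ⟨f, hf, hx⟩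
    obtain ⟨x, hx⟩ := hev.exists
    have hupd (J : Finset ℕ) (hJ : J ⊆ Finset.range m) :
        Z (Function.update h m x) J = Z h J := by
      ext f
      refine forall₂_congr fun j hj => ?_
      have : j ≠ m := (Finset.mem_range.1 (hJ hj)).ne
      simp [this]
    refine ⟨Function.update h m x, fun J hJ => ?_⟩
    by_cases hm : m ∈ J
    · have hJ' : J.erase m ⊆ Finset.range m := fun j hj => by
        have h1 := Finset.mem_range.1 (hJ (Finset.mem_of_mem_erase hj))
        have h2 := Finset.ne_of_mem_erase hj
        simp
        omega
      have hle : Z (Function.update h m x) J ≤ Z h (J.erase m) := by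
        rw [← hupd _ hJ']
        exact fun f hf j hj => hf j (Finset.mem_of_mem_erase hj)
      by_cases hbot : Z h (J.erase m) = ⊥
      · exact Or.inl (le_bot_iff.1 (hbot ▸ hle))
      · have hlt : Z (Function.update h m x) J < Z h (J.erase m) := by
          refine lt_of_le_of_ne hle fun heq => ?_
          obtain ⟨f, hf, hfx⟩ := hx _ (Finset.mem_powerset.2 hJ') hbot
          rw [← heq] at hf
          exact hfx (by simpa using hf m hm)
        have h1 := Submodule.finrank_lt_finrank_of_lt hlt
        have h2 := (hh _ hJ').resolve_left hbot
        have h3 := Finset.card_erase_add_one hm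
        right
        omega
    · have hJ' : J ⊆ Finset.range m := fun j hj => by
        have h1 := Finset.mem_range.1 (hJ hj)
        have h2 : j ≠ m := fun h => hm (h ▸ hj)
        simp
        omega
      rw [hupd _ hJ']
      exact hh J hJ'

theorem Submodule.det_mem_pow {R A : Type*} [CommRing R] [CommRing A] [Algebra R A]
    (S : Submodule R A) {r : ℕ} (M : Matrix (Fin r) (Fin r) A) (hM : ∀ i j, M i j ∈ S) :
    M.det ∈ S ^ r := by
  have hprod (s : Finset (Fin r)) (e : Fin r → A) (he : ∀ i, e i ∈ S) :
      ∏ i ∈ s, e i ∈ S ^ s.card := by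
    classical
    induction s using Finset.induction_on with
    | empty => simp [Submodule.one_le.1 le_rfl]
    | insert a s ha ih =>
      rw [Finset.prod_insert ha, Finset.card_insert_of_notMem ha, pow_succ']
      exact Submodule.mul_mem_mul (he a) ih
  rw [Matrix.det_apply]
  refine Submodule.sum_mem _ fun σ _ => ?_
  have h := hprod Finset.univ (fun i => M (σ i) i) fun i => hM _ _
  rw [Finset.card_univ, Fintype.card_fin] at h
  rcases Int.units_eq_one_or (Equiv.Perm.sign σ) with hσ | hσ
  · simpa [hσ] using h
  · simpa [hσ] using h

theorem Submodule.exists_maximal_finrank {K V : Type*} [Field K] [AddCommGroup V] [Module K V]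
    [FiniteDimensional K V] (p : Submodule K V → Prop) {U : Submodule K V} (hU : p U) :
    ∃ X, p X ∧ ∀ Y, p Y → finrank K Y ≤ finrank K X := by
  obtain ⟨X, hX, hmin⟩ := WellFounded.has_min
    (InvImage.wf (fun X : Submodule K V => finrank K V - finrank K X) wellFounded_lt)
    {X | p X} ⟨U, hU⟩
  refine ⟨X, hX, fun Y hY => ?_⟩
  have h : ¬ finrank K V - finrank K Y < finrank K V - finrank K X := hmin Y hY
  have h1 := Y.finrank_le
  have h2 := X.finrank_le
  omega

theorem Submodule.exists_minimal_finrank {K V : Type*} [Field K] [AddCommGroup V] [Module K V]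
    (p : Submodule K V → Prop) {U : Submodule K V} (hU : p U) :
    ∃ X, p X ∧ ∀ Y, p Y → finrank K X ≤ finrank K Y := by
  obtain ⟨X, hX, hmin⟩ := WellFounded.has_min
    (InvImage.wf (fun X : Submodule K V => finrank K X) wellFounded_lt) {X | p X} ⟨U, hU⟩
  exact ⟨X, hX, fun Y hY => not_lt.1 (hmin Y hY)⟩

namespace Representation

variable {K G V : Type*} [Field K] [Group G] [AddCommGroup V] [Module K V]

/-- The dimension of the intersection of the translate `g • W` with `U`. -/
noncomputable def meetDim (ρ : Representation K G V) (g : G) (W U : Submodule K V) : ℕ :=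
  finrank K ↥(W.map (ρ g) ⊓ U)

/-- The minimal dimension of the intersection of a translate of `W` with `U`. -/
noncomputable def minMeetDim (ρ : Representation K G V) (W U : Submodule K V) : ℕ :=
  ⨅ g, ρ.meetDim g W U

theorem injective_apply (ρ : Representation K G V) (g : G) : Function.Injective (ρ g) :=
  Function.LeftInverse.injective (ρ.inv_self_apply g)

theorem finrank_map_apply (ρ : Representation K G V) (g : G) (U : Submodule K V) :
    finrank K (U.map (ρ g)) = finrank K U :=
  (Submodule.equivMapOfInjective (ρ g) (ρ.injective_apply g) U).finrank_eq.symm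

theorem map_apply_mul (ρ : Representation K G V) (g x : G) (U : Submodule K V) :
    U.map (ρ (g * x)) = (U.map (ρ x)).map (ρ g) := by
  rw [map_mul]
  exact Submodule.map_comp _ _ _

theorem meetDim_map (ρ : Representation K G V) (g x : G) (W U : Submodule K V) :
    ρ.meetDim g W (U.map (ρ x)) = ρ.meetDim (x⁻¹ * g) W U := by
  have h : W.map (ρ g) ⊓ U.map (ρ x) = (W.map (ρ (x⁻¹ * g)) ⊓ U).map (ρ x) := by
    rw [Submodule.map_inf _ (ρ.injective_apply x), ← map_apply_mul, mul_inv_cancel_left]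
  rw [meetDim, h, finrank_map_apply, meetDim]

theorem exists_meetDim_eq (ρ : Representation K G V) (W U : Submodule K V) :
    ∃ g, ρ.meetDim g W U = ρ.minMeetDim W U :=
  Nat.sInf_mem (Set.range_nonempty fun g => ρ.meetDim g W U)

theorem minMeetDim_le (ρ : Representation K G V) (g : G) (W U : Submodule K V) :
    ρ.minMeetDim W U ≤ ρ.meetDim g W U :=
  Nat.sInf_le ⟨g, rfl⟩

theorem minMeetDim_map (ρ : Representation K G V) (x : G) (W U : Submodule K V) :
    ρ.minMeetDim W (U.map (ρ x)) = ρ.minMeetDim W U := by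
  apply le_antisymm
  · obtain ⟨g, hg⟩ := ρ.exists_meetDim_eq W U
    rw [← hg]
    refine (ρ.minMeetDim_le (x * g) _ _).trans ?_
    rw [meetDim_map, inv_mul_cancel_left]
  · obtain ⟨g, hg⟩ := ρ.exists_meetDim_eq W (U.map (ρ x))
    rw [← hg, meetDim_map]
    exact ρ.minMeetDim_le _ _ _

theorem meetDim_top (ρ : Representation K G V) (g : G) (W : Submodule K V) :
    ρ.meetDim g W ⊤ = finrank K W := by
  rw [meetDim, inf_top_eq, finrank_map_apply]

theorem minMeetDim_top (ρ : Representation K G V) (W : Submodule K V) :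
    ρ.minMeetDim W ⊤ = finrank K W := by
  obtain ⟨g, hg⟩ := ρ.exists_meetDim_eq W ⊤
  rw [← hg, meetDim_top]

section FiniteDimensional

variable [FiniteDimensional K V]

theorem meetDim_le_left (ρ : Representation K G V) (g : G) (W U : Submodule K V) :
    ρ.meetDim g W U ≤ finrank K W :=
  (Submodule.finrank_mono inf_le_left).trans (ρ.finrank_map_apply g W).le

theorem meetDim_le_right (ρ : Representation K G V) (g : G) (W U : Submodule K V) :
    ρ.meetDim g W U ≤ finrank K U :=
  Submodule.finrank_mono inf_le_right

theorem meetDim_add_le (ρ : Representation K G V) (g : G) (W U₁ U₂ : Submodule K V) :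
    ρ.meetDim g W U₁ + ρ.meetDim g W U₂ ≤
      ρ.meetDim g W (U₁ ⊔ U₂) + ρ.meetDim g W (U₁ ⊓ U₂) := by
  have h := Submodule.finrank_sup_add_finrank_inf_eq (W.map (ρ g) ⊓ U₁) (W.map (ρ g) ⊓ U₂)
  rw [← inf_inf_distrib_left] at h
  have h' : finrank K ↥(W.map (ρ g) ⊓ U₁ ⊔ W.map (ρ g) ⊓ U₂) ≤ ρ.meetDim g W (U₁ ⊔ U₂) :=
    Submodule.finrank_mono le_inf_sup
  simp only [meetDim] at h' ⊢
  omega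

/-- Along the filter `l`, translates eventually realize the minimal dimensions of
intersections. -/
def GenericFilter (ρ : Representation K G V) (l : Filter G) : Prop :=
  ∀ W U : Submodule K V, ∀ᶠ g in l, ρ.meetDim g W U = ρ.minMeetDim W U

theorem GenericFilter.minMeetDim_add_le {ρ : Representation K G V} {l : Filter G} [l.NeBot]
    (hl : ρ.GenericFilter l) (W U₁ U₂ : Submodule K V) :
    ρ.minMeetDim W U₁ + ρ.minMeetDim W U₂ ≤
      ρ.minMeetDim W (U₁ ⊔ U₂) + ρ.minMeetDim W (U₁ ⊓ U₂) := by
  obtain ⟨g, h₁, h₂⟩ := ((hl W (U₁ ⊔ U₂)).and (hl W (U₁ ⊓ U₂))).exists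
  rw [← h₁, ← h₂]
  exact (Nat.add_le_add (ρ.minMeetDim_le g _ _) (ρ.minMeetDim_le g _ _)).trans
    (ρ.meetDim_add_le g W U₁ U₂)

theorem finrank_sup_map_add (ρ : Representation K G V) (g : G) (X U : Submodule K V) :
    finrank K ↥(X ⊔ U.map (ρ g)) + finrank K ↥(X ⊓ U.map (ρ g)) =
      finrank K X + finrank K U := by
  rw [Submodule.finrank_sup_add_finrank_inf_eq, finrank_map_apply]

theorem minMeetDim_bot (ρ : Representation K G V) (W : Submodule K V) :
    ρ.minMeetDim W ⊥ = 0 := by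
  have h := (ρ.minMeetDim_le 1 W ⊥).trans (ρ.meetDim_le_right 1 W ⊥)
  simpa using h

theorem eq_bot_or_eq_top_of_map_le {ρ : Representation K G V}
    (hirr : ∀ S : Submodule K V, (∀ g, S.map (ρ g) = S) → S = ⊥ ∨ S = ⊤)
    {S : Submodule K V} (hS : ∀ g, S.map (ρ g) ≤ S) : S = ⊥ ∨ S = ⊤ :=
  hirr S fun g => Submodule.eq_of_le_of_finrank_eq (hS g) (ρ.finrank_map_apply g S)

/-- Over an irreducible representation, the generic dimension of intersection is subcritical. -/
theorem GenericFilter.minMeetDim_mul_le {ρ : Representation K G V} {l : Filter G} [l.NeBot]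
    (hl : ρ.GenericFilter l)
    (hirr : ∀ S : Submodule K V, (∀ g, S.map (ρ g) = S) → S = ⊥ ∨ S = ⊤)
    (W U : Submodule K V) :
    ρ.minMeetDim W U * finrank K V ≤ finrank K W * finrank K U := by
  let F (U : Submodule K V) : ℤ :=
    ρ.minMeetDim W U * finrank K V - finrank K W * finrank K U
  have hbdd : ∀ U, F U ≤ finrank K W * finrank K V := fun U => by
    have h1 : ρ.minMeetDim W U ≤ finrank K W :=
      (ρ.minMeetDim_le 1 W U).trans (ρ.meetDim_le_left 1 W U)
    have h2 : ρ.minMeetDim W U * finrank K V ≤ finrank K W * finrank K V :=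
      Nat.mul_le_mul_right _ h1
    zify at h2
    have h3 : (0 : ℤ) ≤ finrank K W * finrank K U := by positivity
    simp only [F]
    linarith
  obtain ⟨M, ⟨U₀, hU₀⟩, hM⟩ := Int.exists_greatest_of_bdd (P := fun z => ∃ U, F U = z)
    ⟨_, by rintro z ⟨U, rfl⟩; exact hbdd U⟩ ⟨_, U, rfl⟩
  obtain ⟨X, hX, hXmax⟩ := Submodule.exists_maximal_finrank (fun U => F U = M) hU₀
  have hmap (g : G) : F (X.map (ρ g)) = M := by
    simp only [F, minMeetDim_map, finrank_map_apply]
    exact hX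
  have hstable (g : G) : X.map (ρ g) ≤ X := by
    have h1 := hl.minMeetDim_add_le W X (X.map (ρ g))
    have h2 := ρ.finrank_sup_map_add g X X
    have h3 := hM _ ⟨X ⊓ X.map (ρ g), rfl⟩
    have h4 := hM _ ⟨X ⊔ X.map (ρ g), rfl⟩
    have h5 := hmap g
    have h6 := ρ.finrank_map_apply g X
    have h7 : F X + F (X.map (ρ g)) ≤ F (X ⊔ X.map (ρ g)) + F (X ⊓ X.map (ρ g)) := by
      zify at h1 h2 h6
      simp only [F]
      rw [h6]
      linear_combination (finrank K V : ℤ) * h1 + (finrank K W : ℤ) * h2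
    have h8 : X ⊔ X.map (ρ g) ≤ X :=
      (Submodule.eq_of_le_of_finrank_le le_sup_left (hXmax _ (by linarith))).ge
    exact le_sup_right.trans h8
  have hM0 : M = 0 := by
    rw [← hX]
    rcases eq_bot_or_eq_top_of_map_le hirr hstable with rfl | rfl
    · simp [F, minMeetDim_bot]
    · simp [F, minMeetDim_top]
  have h := hM _ ⟨U, rfl⟩
  simp only [F, hM0] at h
  zify
  linarith

/-- A subspace realizing the generic bound satisfies the bound for every translate. -/
theorem GenericFilter.meetDim_mul_le_of_eq {ρ : Representation K G V} {l : Filter G} [l.NeBot]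
    (hl : ρ.GenericFilter l)
    (hirr : ∀ S : Submodule K V, (∀ g, S.map (ρ g) = S) → S = ⊥ ∨ S = ⊤)
    (W U : Submodule K V)
    (hU : ρ.minMeetDim W U * finrank K V = finrank K W * finrank K U) (g : G) :
    ρ.meetDim g W U * finrank K V ≤ finrank K W * finrank K U := by
  by_contra! hlt
  let C (U : Submodule K V) : Prop :=
    ρ.minMeetDim W U * finrank K V = finrank K W * finrank K U
  let B (U : Submodule K V) : Prop :=
    finrank K W * finrank K U < ρ.meetDim g W U * finrank K V
  obtain ⟨Y, ⟨hYC, hYB⟩, hYmin⟩ :=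
    Submodule.exists_minimal_finrank (fun U => C U ∧ B U) (U := U) ⟨hU, hlt⟩
  obtain ⟨X, ⟨hXC, hXB⟩, hXmax⟩ :=
    Submodule.exists_maximal_finrank (fun U => C U ∧ B U) ⟨hYC, hYB⟩
  have hXtop : X ≠ ⊤ := by
    rintro rfl
    simp [B, meetDim_top] at hXB
  have hYbot : Y ≠ ⊥ := by
    rintro rfl
    have := ρ.meetDim_le_right g W ⊥
    simp only [finrank_bot, Nat.le_zero] at this
    simp [B, this] at hYB
  obtain ⟨x, hx₁, hx₂⟩ :
      ∃ x, ¬ Y.map (ρ x) ≤ X ∧ ρ.meetDim g W (Y.map (ρ x)) = ρ.minMeetDim W Y := by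
    have hex : ∃ y : G, ¬ Y.map (ρ y) ≤ X := by
      by_contra! hall
      have hle : ⨆ y, Y.map (ρ y) ≤ X := iSup_le hall
      have hY : Y ≤ ⨆ y, Y.map (ρ y) := by
        refine le_trans (le_of_eq ?_) (le_iSup (fun y => Y.map (ρ y)) 1)
        rw [map_one]
        exact (Submodule.map_id Y).symm
      have hstable (y : G) : (⨆ y, Y.map (ρ y)).map (ρ y) ≤ ⨆ y, Y.map (ρ y) := by
        rw [Submodule.map_iSup]
        refine iSup_le fun z => ?_
        rw [← map_apply_mul]
        exact le_iSup (fun y => Y.map (ρ y)) (y * z)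
      rcases eq_bot_or_eq_top_of_map_le hirr hstable with h | h
      · exact hYbot (le_bot_iff.1 (h ▸ hY))
      · exact hXtop (top_le_iff.1 (h ▸ hle))
    obtain ⟨y, hy⟩ := hex
    let X' := X.map (ρ g⁻¹)
    have hlt' : ρ.minMeetDim X' Y < finrank K Y := by
      refine lt_of_le_of_ne ((ρ.minMeetDim_le 1 _ _).trans (ρ.meetDim_le_right 1 _ _)) fun h => ?_
      have h1 := ρ.minMeetDim_le (y⁻¹ * g) X' Y
      rw [h, ← meetDim_map, meetDim, ← map_apply_mul, mul_inv_cancel, map_one] at h1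
      have h2 : X.map (1 : V →ₗ[K] V) = X := Submodule.map_id X
      rw [h2, ← ρ.finrank_map_apply y Y] at h1
      exact hy (inf_eq_right.1 (Submodule.eq_of_le_of_finrank_le inf_le_right h1))
    obtain ⟨z, hz₁, hz₂⟩ := ((hl X' Y).and (hl W Y)).exists
    refine ⟨g * z⁻¹, fun hle => ?_, ?_⟩
    · rw [← hz₁] at hlt'
      have h1 : ρ.meetDim g X' (Y.map (ρ (g * z⁻¹))) = ρ.meetDim z X' Y := by
        rw [meetDim_map]
        simp
      rw [← h1, meetDim, ← map_apply_mul, mul_inv_cancel, map_one] at hlt'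
      have h2 : X.map (1 : V →ₗ[K] V) = X := Submodule.map_id X
      rw [h2, inf_eq_right.2 hle, finrank_map_apply] at hlt'
      exact hlt'.false
    · rw [meetDim_map, ← hz₂]
      simp
  have hfr := ρ.finrank_sup_map_add x X Y
  have hYx := ρ.finrank_map_apply x Y
  have hg := ρ.meetDim_add_le g W X (Y.map (ρ x))
  have hmin := hl.minMeetDim_add_le W X (Y.map (ρ x))
  rw [minMeetDim_map] at hmin
  rw [hx₂] at hg
  have hsup := hl.minMeetDim_mul_le hirr W (X ⊔ Y.map (ρ x))
  have hinf := hl.minMeetDim_mul_le hirr W (X ⊓ Y.map (ρ x))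
  have hmin' := Nat.mul_le_mul_right (finrank K V) hmin
  have hg' := Nat.mul_le_mul_right (finrank K V) hg
  have hfr' := congrArg (finrank K W * ·) hfr
  simp only [C, B] at hXC hXB hYC
  simp only [add_mul, mul_add] at hmin' hg' hfr'
  have hsupC : C (X ⊔ Y.map (ρ x)) := by
    simp only [C]
    omega
  have hinfC : C (X ⊓ Y.map (ρ x)) := by
    simp only [C]
    omega
  have hinfB : ¬ B (X ⊓ Y.map (ρ x)) := fun h => by
    have h1 := hYmin _ ⟨hinfC, h⟩
    rw [← hYx] at h1
    exact hx₁ (inf_eq_right.1 (Submodule.eq_of_le_of_finrank_le inf_le_right h1))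
  have hsupB : B (X ⊔ Y.map (ρ x)) := by
    simp only [B] at hinfB ⊢
    omega
  have h1 := Submodule.eq_of_le_of_finrank_le le_sup_left (hXmax _ ⟨hsupC, hsupB⟩)
  exact hx₁ (le_sup_right.trans h1.ge)

end FiniteDimensional

/-- The space of matrix coefficients of a representation. -/
noncomputable def matrixCoefficients (ρ : Representation K G V) : Submodule K (G → K) :=
  LinearMap.range (LinearMap.pi fun g => LinearMap.applyₗ (R := K) (M₂ := K) (ρ g))

/-- The algebra of functions generated by the matrix coefficients of a representation. -/
noncomputable def coefficientAlgebra (ρ : Representation K G V) : Subalgebra K (G → K) :=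
  Algebra.adjoin K ρ.matrixCoefficients

/-- The space of homogeneous polynomials of degree at most `dim V` in the matrix coefficients. -/
noncomputable def minorSpace (ρ : Representation K G V) : Submodule K (G → K) :=
  ⨆ r : Fin (finrank K V + 1), ρ.matrixCoefficients ^ (r : ℕ)

theorem apply_mem_matrixCoefficients (ρ : Representation K G V) (φ : (V →ₗ[K] V) →ₗ[K] K) :
    (fun g => φ (ρ g)) ∈ ρ.matrixCoefficients :=
  ⟨φ, rfl⟩

theorem mul_left_mem_coefficientAlgebra (ρ : Representation K G V) (g : G) {f : G → K}
    (hf : f ∈ ρ.coefficientAlgebra) : (fun x => f (g * x)) ∈ ρ.coefficientAlgebra := by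
  induction hf using Algebra.adjoin_induction with
  | mem f hf =>
    obtain ⟨φ, rfl⟩ := hf
    refine Algebra.subset_adjoin ⟨φ ∘ₗ LinearMap.mulLeft K (ρ g), ?_⟩
    ext x
    simp
  | algebraMap r => exact ρ.coefficientAlgebra.algebraMap_mem r
  | add f₁ f₂ _ _ h₁ h₂ => exact ρ.coefficientAlgebra.add_mem h₁ h₂
  | mul f₁ f₂ _ _ h₁ h₂ => exact ρ.coefficientAlgebra.mul_mem h₁ h₂

theorem minorSpace_le_coefficientAlgebra (ρ : Representation K G V) :
    ρ.minorSpace ≤ Subalgebra.toSubmodule ρ.coefficientAlgebra := by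
  refine iSup_le fun r => ?_
  induction (r : ℕ) with
  | zero =>
    rw [pow_zero, Submodule.one_le]
    exact ρ.coefficientAlgebra.one_mem
  | succ n ih =>
    rw [pow_succ, Submodule.mul_le]
    exact fun a ha b hb => ρ.coefficientAlgebra.mul_mem (ih ha) (Algebra.subset_adjoin hb)

variable [FiniteDimensional K V]

theorem fg_matrixCoefficients (ρ : Representation K G V) : ρ.matrixCoefficients.FG := by
  rw [matrixCoefficients, LinearMap.range_eq_map]
  exact Module.Finite.fg_top.map _

theorem fg_coefficientAlgebra (ρ : Representation K G V) : ρ.coefficientAlgebra.FG := by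
  obtain ⟨t, ht⟩ := ρ.fg_matrixCoefficients
  rw [coefficientAlgebra, ← ht, Algebra.adjoin_span]
  exact Subalgebra.fg_adjoin_finset t

instance finiteDimensional_minorSpace (ρ : Representation K G V) :
    FiniteDimensional K ρ.minorSpace :=
  Module.Finite.iff_fg.2 (Submodule.fg_iSup _ fun r => ρ.fg_matrixCoefficients.pow r)

/-- The map induced by `ρ g` from a subspace to a quotient space. -/
def subquotientMap (ρ : Representation K G V) (g : G) (W U : Submodule K V) : W →ₗ[K] V ⧸ U :=
  U.mkQ ∘ₗ ρ g ∘ₗ W.subtype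

theorem finrank_range_subquotientMap_add_meetDim (ρ : Representation K G V) (g : G)
    (W U : Submodule K V) :
    finrank K (LinearMap.range (ρ.subquotientMap g W U)) + ρ.meetDim g W U = finrank K W := by
  have hinj : Function.Injective (ρ g ∘ₗ W.subtype) :=
    (ρ.injective_apply g).comp W.injective_subtype
  have hker : (LinearMap.ker (ρ.subquotientMap g W U)).map (ρ g ∘ₗ W.subtype) =
      W.map (ρ g) ⊓ U := by
    ext v
    simp only [subquotientMap, Submodule.mem_map, LinearMap.mem_ker, Submodule.mem_inf]
    constructor
    · rintro ⟨w, hw, rfl⟩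
      exact ⟨⟨w, w.2, rfl⟩, by simpa using hw⟩
    · rintro ⟨⟨w, hw, rfl⟩, hU⟩
      exact ⟨⟨w, hw⟩, by simpa using hU, rfl⟩
  rw [meetDim, ← hker, ← (Submodule.equivMapOfInjective _ hinj _).finrank_eq]
  exact LinearMap.finrank_range_add_finrank_ker _

/-- The minimality of the dimension of an intersection is witnessed by a minor. -/
theorem exists_minor (ρ : Representation K G V) (W U : Submodule K V) :
    ∃ f ∈ ρ.minorSpace, f ≠ 0 ∧ ∀ g, f g ≠ 0 → ρ.meetDim g W U = ρ.minMeetDim W U := by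
  obtain ⟨g₀, hg₀⟩ := ρ.exists_meetDim_eq W U
  let T (g : G) := ρ.subquotientMap g W U
  let r := finrank K (LinearMap.range (T g₀))
  let b : Basis (Fin r) K (LinearMap.range (T g₀)) := finBasis K _
  obtain ⟨p, hp⟩ := (LinearMap.range (T g₀)).subtype.exists_leftInverse_of_injective
    (Submodule.ker_subtype _)
  choose v hv using fun i => (b i).2
  let ψ (j : Fin r) : V ⧸ U →ₗ[K] K := b.coord j ∘ₗ p
  let M : Matrix (Fin r) (Fin r) (G → K) := Matrix.of fun i j g => ψ j (T g (v i))
  have hdet (g : G) : M.det g = (Matrix.of fun i j => ψ j (T g (v i))).det :=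
    (Pi.evalRingHom (fun _ : G => K) g).map_det M
  have hone : M.det g₀ = 1 := by
    rw [hdet]
    convert Matrix.det_one (n := Fin r) (R := K)
    ext i j
    have h : p (b i) = b i := LinearMap.congr_fun hp (b i)
    simp only [Matrix.of_apply, hv, ψ, LinearMap.comp_apply, h, Basis.coord_apply,
      Basis.repr_self, Matrix.one_apply, Finsupp.single_apply]
  have hr : r ≤ finrank K V := by
    have h := ρ.finrank_range_subquotientMap_add_meetDim g₀ W U
    have h' := W.finrank_le
    exact (Nat.le_of_add_right_le h.le).trans h'
  have hmem : M.det ∈ ρ.minorSpace := by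
    refine Submodule.mem_iSup_of_mem ⟨r, Nat.lt_succ_of_le hr⟩ (Submodule.det_mem_pow _ _ ?_)
    intro i j
    exact ρ.apply_mem_matrixCoefficients
      (ψ j ∘ₗ U.mkQ ∘ₗ LinearMap.applyₗ (R := K) (M₂ := V) (v i : V))
  refine ⟨M.det, hmem, Function.ne_iff.2 ⟨g₀, by simp [hone]⟩, fun g hg => ?_⟩
  rw [hdet] at hg
  have hli : LinearIndependent K fun i => T g (v i) :=
    LinearIndependent.of_comp (LinearMap.pi ψ) (Matrix.linearIndependent_rows_of_det_ne_zero hg)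
  have hli' : LinearIndependent K fun i =>
      (⟨T g (v i), v i, rfl⟩ : LinearMap.range (T g)) :=
    LinearIndependent.of_comp (LinearMap.range (T g)).subtype hli
  have hcard : r ≤ finrank K (LinearMap.range (T g)) := by
    simpa using hli'.fintype_card_le_finrank
  have h₀ := ρ.finrank_range_subquotientMap_add_meetDim g₀ W U
  have h₁ := ρ.finrank_range_subquotientMap_add_meetDim g W U
  have h₂ := ρ.minMeetDim_le g W U
  simp only [r, T] at hcard
  omega

/-- Averaged intersection bound for an irreducible representation whose algebra of matrix
coefficients has no zero divisors. -/
theorem exists_sum_meetDim_mul_le (ρ : Representation K G V) (l : Filter G) [l.NeBot]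
    (hl : ∀ f ∈ ρ.coefficientAlgebra, f ≠ 0 → ∀ᶠ g in l, f g ≠ 0)
    (hirr : ∀ S : Submodule K V, (∀ g, S.map (ρ g) = S) → S = ⊥ ∨ S = ⊤)
    (W : Submodule K V) :
    ∃ m : ℕ, 0 < m ∧ ∃ h : Fin m → G, ∀ U : Submodule K V,
      (∑ j, ρ.meetDim (h j) W U) * finrank K V ≤ m * (finrank K W * finrank K U) := by
  classical
  have hl' : ∀ f ∈ ρ.minorSpace, f ≠ 0 → ∀ᶠ g in l, f g ≠ 0 := fun f hf =>
    hl f (ρ.minorSpace_le_coefficientAlgebra hf)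
  have hgen : ρ.GenericFilter l := fun W U => by
    obtain ⟨f, hf, hf0, hfU⟩ := ρ.exists_minor W U
    filter_upwards [hl' f hf hf0] with g hg using hfU g hg
  let N := finrank K ρ.minorSpace * (finrank K W * finrank K V)
  obtain ⟨h, hh⟩ := ρ.minorSpace.exists_seq_card_zeros_le l hl' (N + 1)
  refine ⟨N + 1, N.succ_pos, fun j => h j, fun U => ?_⟩
  rw [Fin.sum_univ_eq_sum_range fun j => ρ.meetDim (h j) W U]
  rcases (hgen.minMeetDim_mul_le hirr W U).eq_or_lt with heq | hlt
  · rw [Finset.sum_mul]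
    refine (Finset.sum_le_card_nsmul _ _ (finrank K W * finrank K U) fun j _ =>
      hgen.meetDim_mul_le_of_eq hirr W U heq (h j)).trans ?_
    simp
  · obtain ⟨f, hf, hf0, hfU⟩ := ρ.exists_minor W U
    have hJ := hh f hf hf0 ((Finset.range (N + 1)).filter fun j => f (h j) = 0)
      (Finset.filter_subset _ _) fun j hj => (Finset.mem_filter.1 hj).2
    have hterm (j : ℕ) : ρ.meetDim (h j) W U ≤
        ρ.minMeetDim W U + if f (h j) = 0 then finrank K W else 0 := by
      split_ifs with h0
      · exact (ρ.meetDim_le_left _ _ _).trans (Nat.le_add_left _ _)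
      · exact (hfU _ h0).le
    have hsum : ∑ j ∈ Finset.range (N + 1), ρ.meetDim (h j) W U ≤
        (N + 1) * ρ.minMeetDim W U + finrank K ρ.minorSpace * finrank K W := by
      refine (Finset.sum_le_sum fun j _ => hterm j).trans ?_
      rw [Finset.sum_add_distrib, ← Finset.sum_filter, Finset.sum_const, Finset.sum_const,
        Finset.card_range, smul_eq_mul, smul_eq_mul]
      gcongr
    calc _ ≤ ((N + 1) * ρ.minMeetDim W U + finrank K ρ.minorSpace * finrank K W) *
          finrank K V := Nat.mul_le_mul_right _ hsum
      _ = (N + 1) * (ρ.minMeetDim W U * finrank K V) + N := by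
        simp only [N]
        ring
      _ ≤ (N + 1) * (ρ.minMeetDim W U * finrank K V + 1) := by
        rw [mul_add]
        omega
      _ ≤ _ := Nat.mul_le_mul_left _ hlt

end Representation

/-- Subcritical averaged intersection bound: if a norm-topology connected
subgroup `H` of `GL(V)` acts irreducibly on the nonzero finite-dimensional
real vector space `V`, then for every subspace `W` there are `m ≥ 1` and
`h₁, …, h_m ∈ H` (independent of `W'`) such that for every subspace `W'`,
`Σ_j dim((h_j·W) ∩ W') · dim V ≤ m · dim W · dim W'`. -/
theorem subcritical_intersection_average
    (V : Type*) [NormedAddCommGroup V] [NormedSpace ℝ V]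
    [FiniteDimensional ℝ V] [Nontrivial V]
    (H : Subgroup (V →L[ℝ] V)ˣ)
    (hconn : IsConnected (H : Set (V →L[ℝ] V)ˣ))
    (hirr : ∀ S : Submodule ℝ V,
      (∀ h ∈ H, S.map ((h : V →L[ℝ] V) : V →ₗ[ℝ] V) = S) → S = ⊥ ∨ S = ⊤)
    (W : Submodule ℝ V) :
    ∃ m : ℕ, 0 < m ∧ ∃ h : Fin m → (V →L[ℝ] V)ˣ, (∀ j, h j ∈ H) ∧
      ∀ W' : Submodule ℝ V,
        (∑ j : Fin m,
            finrank ℝ ↥(W.map ((h j : V →L[ℝ] V) : V →ₗ[ℝ] V) ⊓ W')) *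
          finrank ℝ V ≤
        m * (finrank ℝ ↥W * finrank ℝ ↥W') := by
  let ρ : Representation ℝ H V :=
    { toFun h := ((h.1 : V →L[ℝ] V) : V →ₗ[ℝ] V)
      map_one' := rfl
      map_mul' _ _ := rfl }
  have : PreconnectedSpace H := Subtype.preconnectedSpace hconn.isPreconnected
  have hcont : ∀ f ∈ ρ.coefficientAlgebra, Continuous f := fun f hf => by
    induction hf using Algebra.adjoin_induction with
    | mem f hf =>
      obtain ⟨φ, rfl⟩ := hf
      exact (LinearMap.continuous_of_finiteDimensional
        (φ ∘ₗ ContinuousLinearMap.coeLM (R := ℝ) (M := V) (N₃ := V) ℝ)).comp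
          (Units.continuous_val.comp continuous_subtype_val)
    | algebraMap r => exact continuous_const
    | add f₁ f₂ _ _ h₁ h₂ => exact h₁.add h₂
    | mul f₁ f₂ _ _ h₁ h₂ => exact h₁.mul h₂
  obtain ⟨l, hl, hgen⟩ := ρ.coefficientAlgebra.exists_neBot_eventually_ne_zero
    fun f₁ hf₁ f₂ hf₂ h₁ h₂ =>
      ρ.coefficientAlgebra.exists_ne_zero_and_ne_zero ρ.fg_coefficientAlgebra hcont
        (fun g _ hf => ρ.mul_left_mem_coefficientAlgebra g hf) hf₁ hf₂ h₁ h₂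
  obtain ⟨m, hm, h, hW⟩ := ρ.exists_sum_meetDim_mul_le l hgen
    (fun S hS => hirr S fun h hh => hS ⟨h, hh⟩) W
  exact ⟨m, hm, fun j => h j, fun j => (h j).2, hW⟩
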